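/- arXiv:1306.5331 — 2 statements merged into one kernel-verified Lean document; each statement's English description precedes it below -/
import Mathlib

section
/- Let T : X → X be a bounded linear operator on an infinite dimensional Banach space X with a coarsely dense orbit O(x,T,d) on an open cone C (i.e., C ⊆ O(x,T,d)). Then T is hypercyclic: there exists a vector whose orbit is dense in X. -/
open Filter Topology

variable {X : Type*} [NormedAddCommGroup X] [NormedSpace ℂ X]

/-- The orbit of `x` under `T`. -/
def orbitSet (T : X →L[ℂ] X) (x : X) : Set X := Set.range fun n : ℕ => (T ^ n) x

/-- The coarse orbit of `x` under `T` with respect to `d`. -/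
def coarseOrbit (T : X →L[ℂ] X) (x : X) (d : ℝ) : Set X :=
  {y | ∃ n : ℕ, ‖(T ^ n) x - y‖ < d}

/-- The extended (prolongational) limit set `J(x,T)`. -/
def jSet (T : X →L[ℂ] X) (x : X) : Set X :=
  {y | ∃ k : ℕ → ℕ, StrictMono k ∧ (∀ n, 0 < k n) ∧
    ∃ u : ℕ → X, Tendsto u atTop (𝓝 x) ∧
      Tendsto (fun n => (T ^ k n) (u n)) atTop (𝓝 y)}

/-- The coarse extended limit set `J(x,T,d)`. -/
def jCoarse (T : X →L[ℂ] X) (x : X) (d : ℝ) : Set X :=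
  {y | ∃ k : ℕ → ℕ, StrictMono k ∧ (∀ n, 0 < k n) ∧
    ∃ u : ℕ → X, Tendsto u atTop (𝓝 x) ∧ ∀ n, ‖(T ^ k n) (u n) - y‖ < d}

/-- The extended mixing limit set `J^{mix}(x,T)`. -/
def jMix (T : X →L[ℂ] X) (x : X) : Set X :=
  {y | ∃ u : ℕ → X, Tendsto u atTop (𝓝 x) ∧
    Tendsto (fun n => (T ^ n) (u n)) atTop (𝓝 y)}

/-- The coarse extended mixing limit set `J^{mix}(x,T,d)`. -/
def jMixCoarse (T : X →L[ℂ] X) (x : X) (d : ℝ) : Set X :=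
  {y | ∃ u : ℕ → X, Tendsto u atTop (𝓝 x) ∧ ∀ n, ‖(T ^ n) (u n) - y‖ < d}

/-- The prolongation `D(x,T) = O(x,T) ∪ J(x,T)`. -/
def dSet (T : X →L[ℂ] X) (x : X) : Set X := orbitSet T x ∪ jSet T x

/-- The coarse prolongation `D(x,T,d) = O(x,T,d) ∪ J(x,T,d)`. -/
def dCoarse (T : X →L[ℂ] X) (x : X) (d : ℝ) : Set X :=
  coarseOrbit T x d ∪ jCoarse T x d

/-- The coarse mixing prolongation `D^{mix}(x,T,d)`. -/
def dMixCoarse (T : X →L[ℂ] X) (x : X) (d : ℝ) : Set X :=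
  coarseOrbit T x d ∪ jMixCoarse T x d

/-- An open cone: a nonempty open set invariant under positive scalar multiplication. -/
def IsOpenCone (C : Set X) : Prop :=
  IsOpen C ∧ C.Nonempty ∧ ∀ x ∈ C, ∀ r : ℝ, 0 < r → (r : ℂ) • x ∈ C

/-- A geometric progression of nonnegative reals stays away from some positive real. -/
theorem exists_pos_forall_le_abs_geometric_sub {b s : ℝ} (hb : 0 ≤ b) (hs : 0 ≤ s) :
    ∃ r > 0, ∃ δ > 0, ∀ n : ℕ, δ ≤ |b * s ^ n - r| := by
  rcases le_or_gt s 1 with h | h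
  · refine ⟨b + 1, by positivity, 1, one_pos, fun n => ?_⟩
    have : b * s ^ n ≤ b := mul_le_of_le_one_right hb (pow_le_one₀ hs h)
    rw [abs_sub_comm]
    exact le_trans (by linarith) (le_abs_self _)
  rcases hb.eq_or_lt with rfl | hb
  · exact ⟨1, one_pos, 1, one_pos, fun n => by simp⟩
  refine ⟨b * ((1 + s) / 2), by positivity, b * ((s - 1) / 2),
    mul_pos hb (by linarith), fun n => ?_⟩
  rw [← mul_sub, abs_mul, abs_of_pos hb]
  refine mul_le_mul_of_nonneg_left ?_ hb.le
  rcases n with _ | n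
  · rw [abs_sub_comm]
    exact le_trans (by simp; linarith) (le_abs_self _)
  · have : s ≤ s ^ (n + 1) := le_self_pow₀ h.le (by simp)
    exact le_trans (by linarith) (le_abs_self _)

theorem Submodule.eq_top_of_isOpen_subset {M : Submodule ℂ X} {C : Set X} (hC : IsOpen C)
    (hne : C.Nonempty) (h : C ⊆ M) : M = ⊤ :=
  M.eq_top_of_nonempty_interior' (hne.mono (interior_maximal h hC))

theorem Submodule.dense_of_isOpen_subset_closure {M : Submodule ℂ X} {C : Set X} (hC : IsOpen C)
    (hne : C.Nonempty) (h : C ⊆ closure M) : Dense (M : Set X) :=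
  Submodule.dense_iff_topologicalClosure_eq_top.2
    (Submodule.eq_top_of_isOpen_subset hC hne (by simpa using h))

theorem denseRange_sub_algebraMap {T : X →L[ℂ] X} {z : X} {C : Set X} (hC : IsOpenCone C)
    (hz : C ⊆ closure (orbitSet T z)) (a : ℂ) :
    DenseRange (T - algebraMap ℂ (X →L[ℂ] X) a) := by
  obtain ⟨hCo, hCne, hCs⟩ := hC
  set S := T - algebraMap ℂ (X →L[ℂ] X) a with hS
  set M : Submodule ℂ X := (LinearMap.range (S : X →ₗ[ℂ] X)).topologicalClosure
  have : IsClosed (M : Set X) := Submodule.isClosed_topologicalClosure _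
  suffices M = ⊤ by
    exact Submodule.dense_iff_topologicalClosure_eq_top.2 this
  by_contra hne
  obtain ⟨c, hc, hcM⟩ : ∃ c ∈ C, c ∉ M := by
    by_contra! h
    exact hne (Submodule.eq_top_of_isOpen_subset hCo hCne h)
  have hc0 : 0 < ‖M.mkQ c‖ := by
    rw [norm_pos_iff]
    simpa using hcM
  have hπT (y : X) : M.mkQ (T y) = a • M.mkQ y := by
    rw [← map_smul, ← sub_eq_zero, ← map_sub, Submodule.mkQ_apply,
      Submodule.Quotient.mk_eq_zero]
    exact Submodule.le_topologicalClosure _ ⟨y, by simp [hS, Algebra.algebraMap_eq_smul_one]⟩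
  have hπ (n : ℕ) : M.mkQ ((T ^ n) z) = a ^ n • M.mkQ z := by
    induction n with
    | zero => simp
    | succ n ih => rw [pow_succ', mul_apply_eq_comp, hπT, ih, smul_smul, pow_succ']
  obtain ⟨r, hr, δ, hδ, hrδ⟩ :=
    exists_pos_forall_le_abs_geometric_sub (norm_nonneg (M.mkQ z)) (norm_nonneg a)
  obtain ⟨_, ⟨n, rfl⟩, hn⟩ := Metric.mem_closure_iff.1
    (hz (hCs c hc (r / ‖M.mkQ c‖) (by positivity))) δ hδ
  refine (hrδ n).not_gt ?_
  have h1 : ‖M.mkQ ((T ^ n) z)‖ = ‖M.mkQ z‖ * ‖a‖ ^ n := by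
    rw [hπ, norm_smul, norm_pow, mul_comm]
  have h2 : ‖M.mkQ (((r / ‖M.mkQ c‖ : ℝ) : ℂ) • c)‖ = r := by
    rw [map_smul, norm_smul, Complex.norm_real, Real.norm_of_nonneg (by positivity)]
    field_simp
  rw [← h1]
  nth_rewrite 1 [← h2]
  refine (abs_norm_sub_norm_le _ _).trans_lt ?_
  rw [← map_sub]
  refine (Submodule.Quotient.norm_mk_le M _).trans_lt ?_
  rwa [← dist_eq_norm, dist_comm]

theorem denseRange_aeval {T : X →L[ℂ] X}
    (h : ∀ a : ℂ, DenseRange (T - algebraMap ℂ (X →L[ℂ] X) a)) {p : Polynomial ℂ}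
    (hp : p ≠ 0) : DenseRange (Polynomial.aeval T p) := by
  induction hn : p.natDegree generalizing p with
  | zero =>
    rw [Polynomial.eq_C_of_natDegree_eq_zero hn] at hp ⊢
    refine Function.Surjective.denseRange fun y => ⟨(p.coeff 0)⁻¹ • y, ?_⟩
    have : p.coeff 0 ≠ 0 := by simpa using hp
    simp [Algebra.algebraMap_eq_smul_one, smul_smul, this]
  | succ n ih =>
    obtain ⟨a, ha⟩ := IsAlgClosed.exists_root p
      (by rw [Polynomial.degree_eq_natDegree hp, hn]; exact_mod_cast n.succ_ne_zero)
    obtain ⟨q, rfl⟩ := Polynomial.dvd_iff_isRoot.2 ha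
    have hq : q ≠ 0 := right_ne_zero_of_mul hp
    rw [Polynomial.natDegree_mul (Polynomial.X_sub_C_ne_zero a) hq,
      Polynomial.natDegree_X_sub_C] at hn
    have := (h a).comp (ih hq (by omega)) (ContinuousLinearMap.continuous _)
    simpa [Function.comp_def, DenseRange, mul_apply_eq_comp] using this

/-- If the orbit of `x` is coarsely dense on a cone, then the orbit of every small enough positive
multiple of `x` visits a given open set meeting the cone infinitely often. -/
theorem exists_forall_exists_gt_norm_smul_sub_lt (hinf : ¬ FiniteDimensional ℂ X)
    {T : X →L[ℂ] X} {x : X} {d : ℝ} (hd : 0 < d) {C : Set X} (hC : IsOpenCone C)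
    (hdense : C ⊆ coarseOrbit T x d) {V : Set X} (hV : IsOpen V) (hVC : (V ∩ C).Nonempty) :
    ∃ ε₀ > 0, ∀ ε : ℝ, 0 < ε → ε ≤ ε₀ → ∀ n : ℕ, ∃ m > n, (T ^ m) ((ε : ℂ) • x) ∈ V := by
  obtain ⟨hCo, -, hCs⟩ := hC
  obtain ⟨v, hv⟩ := hVC
  obtain ⟨r, hr, hball⟩ := Metric.isOpen_iff.1 (hV.inter hCo) v hv
  obtain ⟨R, f, hR, hfR, hf⟩ := exists_seq_norm_le_one_le_norm_sub (𝕜 := ℂ) hinf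
  have hR0 : 0 < R := by linarith
  set s : ℝ := r / (2 * R) with hs
  have hs0 : 0 < s := by positivity
  have hsR : s * R = r / 2 := by rw [hs]; field_simp
  refine ⟨min (s / (2 * d)) (r / (2 * d)), by positivity, fun ε hε hεle n => ?_⟩
  have hεs : ε * d ≤ s / 2 := by
    have := mul_le_mul_of_nonneg_right (hεle.trans (min_le_left _ _)) hd.le
    calc _ ≤ _ := this
      _ = s / 2 := by field_simp
  have hεr : ε * d ≤ r / 2 := by
    have := mul_le_mul_of_nonneg_right (hεle.trans (min_le_right _ _)) hd.le
    calc _ ≤ _ := this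
      _ = r / 2 := by field_simp
  have hit (y : X) (hy : y ∈ C) : ∃ m : ℕ, ‖(T ^ m) ((ε : ℂ) • x) - y‖ < ε * d := by
    obtain ⟨m, hm⟩ := hdense (hCs y hy ε⁻¹ (by positivity))
    refine ⟨m, ?_⟩
    have hεC : (ε : ℂ) ≠ 0 := by exact_mod_cast hε.ne'
    have : (T ^ m) ((ε : ℂ) • x) - y = (ε : ℂ) • ((T ^ m) x - ((ε⁻¹ : ℝ) : ℂ) • y) := by
      rw [smul_sub, smul_smul, map_smul, Complex.ofReal_inv, mul_inv_cancel₀ hεC, one_smul]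
    rw [this, norm_smul, Complex.norm_real, Real.norm_of_nonneg hε.le]
    exact mul_lt_mul_of_pos_left hm hε
  have hy (i : ℕ) : ‖(s : ℂ) • f i‖ ≤ r / 2 := by
    rw [norm_smul, Complex.norm_real, Real.norm_of_nonneg hs0.le, ← hsR]
    exact mul_le_mul_of_nonneg_left (hfR i) hs0.le
  have hyC (i : ℕ) : v + (s : ℂ) • f i ∈ C := by
    refine (hball ?_).2
    rw [Metric.mem_ball, dist_eq_norm, add_sub_cancel_left]
    linarith [hy i]
  choose m hm using fun i => hit _ (hyC i)
  obtain ⟨i, hi⟩ : ∃ i, n < m i := by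
    by_contra! h
    obtain ⟨i, j, hij, he⟩ := Finite.exists_ne_map_eq_of_infinite
      fun i => (⟨m i, Nat.lt_succ_of_le (h i)⟩ : Fin (n + 1))
    have he : m i = m j := by simpa using he
    have h1 := hm i
    have h2 := hm j
    rw [he, norm_sub_rev] at h1
    have h3 := norm_add_le (v + (s : ℂ) • f i - (T ^ m j) ((ε : ℂ) • x))
      ((T ^ m j) ((ε : ℂ) • x) - (v + (s : ℂ) • f j))
    rw [sub_add_sub_cancel, add_sub_add_left_eq_sub, ← smul_sub, norm_smul, Complex.norm_real,
      Real.norm_of_nonneg hs0.le] at h3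
    have h4 := mul_le_mul_of_nonneg_left (hf hij) hs0.le
    linarith
  refine ⟨m i, hi, (hball ?_).1⟩
  rw [Metric.mem_ball, dist_eq_norm]
  have := norm_add_le ((T ^ m i) ((ε : ℂ) • x) - (v + (s : ℂ) • f i)) ((s : ℂ) • f i)
  rw [show (T ^ m i) ((ε : ℂ) • x) - (v + (s : ℂ) • f i) + (s : ℂ) • f i
    = (T ^ m i) ((ε : ℂ) • x) - v by abel] at this
  linarith [hy i, hm i]

/-- A coarsely dense orbit on an open cone makes `T` topologically transitive on that cone. -/
theorem exists_pow_succ_mem_of_coarsely_dense (hinf : ¬ FiniteDimensional ℂ X)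
    {T : X →L[ℂ] X} {x : X} {d : ℝ} (hd : 0 < d) {C : Set X} (hC : IsOpenCone C)
    (hdense : C ⊆ coarseOrbit T x d) {U V : Set X} (hU : IsOpen U) (hUC : (U ∩ C).Nonempty)
    (hV : IsOpen V) (hVC : (V ∩ C).Nonempty) :
    ∃ n : ℕ, ∃ y ∈ U, (T ^ (n + 1)) y ∈ V := by
  obtain ⟨ε₁, h₁, hε₁⟩ := exists_forall_exists_gt_norm_smul_sub_lt hinf hd hC hdense hU hUC
  obtain ⟨ε₂, h₂, hε₂⟩ := exists_forall_exists_gt_norm_smul_sub_lt hinf hd hC hdense hV hVC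
  obtain ⟨n, -, hn⟩ := hε₁ (min ε₁ ε₂) (by positivity) (min_le_left _ _) 0
  obtain ⟨m, hm, hm'⟩ := hε₂ (min ε₁ ε₂) (by positivity) (min_le_right _ _) n
  obtain ⟨k, rfl⟩ := Nat.exists_eq_add_of_lt hm
  refine ⟨k, _, hn, ?_⟩
  rwa [← mul_apply_eq_comp, ← pow_add, show k + 1 + n = n + k + 1 by omega]

theorem separableSpace_of_coarsely_dense {T : X →L[ℂ] X} {x : X} {d : ℝ} (hd : 0 < d)
    {C : Set X} (hC : IsOpenCone C) (hdense : C ⊆ coarseOrbit T x d) :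
    TopologicalSpace.SeparableSpace X := by
  obtain ⟨hCo, hCne, hCs⟩ := hC
  have hsep : TopologicalSpace.IsSeparable
      (Submodule.span ℂ (orbitSet T x) : Set X) :=
    (Set.countable_range _).isSeparable.span
  have hspan : Dense (Submodule.span ℂ (orbitSet T x) : Set X) := by
    refine Submodule.dense_of_isOpen_subset_closure hCo hCne fun y hy => ?_
    refine Metric.mem_closure_iff.2 fun ε hε => ?_
    obtain ⟨m, hm⟩ := hdense (hCs y hy (d / ε) (by positivity))
    refine ⟨((ε / d : ℝ) : ℂ) • (T ^ m) x,
      Submodule.smul_mem _ _ (Submodule.subset_span ⟨m, rfl⟩), ?_⟩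
    have : ((ε / d : ℝ) : ℂ) • (T ^ m) x - y
        = ((ε / d : ℝ) : ℂ) • ((T ^ m) x - ((d / ε : ℝ) : ℂ) • y) := by
      rw [smul_sub, smul_smul, ← Complex.ofReal_mul,
        show ε / d * (d / ε) = 1 by field_simp, Complex.ofReal_one, one_smul]
    rw [dist_comm, dist_eq_norm, this, norm_smul, Complex.norm_real,
      Real.norm_of_nonneg (by positivity)]
    calc ε / d * _ < ε / d * d := mul_lt_mul_of_pos_left hm (by positivity)
      _ = ε := by field_simp
  rw [← TopologicalSpace.isSeparable_univ_iff, ← hspan.closure_eq]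
  exact hsep.closure

/-- Birkhoff's transitivity theorem, localized to an open set. -/
theorem exists_mem_subset_closure_range_iterate {Y : Type*} [TopologicalSpace Y] [BaireSpace Y]
    [SecondCountableTopology Y] {g : ℕ → Y → Y} (hg : ∀ n, Continuous (g n)) {C : Set Y}
    (hC : IsOpen C) (hne : C.Nonempty)
    (h : ∀ U V : Set Y, IsOpen U → IsOpen V → (U ∩ C).Nonempty → (V ∩ C).Nonempty →
      ∃ n, ∃ y ∈ U, g n y ∈ V) :
    ∃ z ∈ C, C ⊆ closure (Set.range fun n => g n z) := by
  let B := {V ∈ TopologicalSpace.countableBasis Y | (V ∩ C).Nonempty}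
  have hB : B.Countable := (TopologicalSpace.countable_countableBasis Y).mono fun V hV => hV.1
  have hBo (V : Set Y) (hV : V ∈ B) : IsOpen V :=
    TopologicalSpace.isOpen_of_mem_countableBasis hV.1
  have : Countable B := hB.to_subtype
  have hd : Dense (⋂ V : B, ((⋃ n, g n ⁻¹' (V : Set Y)) ∪ (closure C)ᶜ)) := by
    refine dense_iInter_of_isOpen (fun V => ?_) fun V => ?_
    · exact (isOpen_iUnion fun n => (hBo V V.2).preimage (hg n)).union isClosed_closure.isOpen_compl
    · refine dense_iff_inter_open.2 fun U hU hUne => ?_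
      by_cases hUC : (U ∩ C).Nonempty
      · obtain ⟨n, y, hyU, hy⟩ := h U V hU (hBo V V.2) hUC V.2.2
        exact ⟨y, hyU, Or.inl (Set.mem_iUnion.2 ⟨n, hy⟩)⟩
      · obtain ⟨y, hy⟩ := hUne
        exact ⟨y, hy, Or.inr fun hyC => hUC (mem_closure_iff.1 hyC U hU hy)⟩
  obtain ⟨z, hzC, hz⟩ := hd.inter_open_nonempty C hC hne
  refine ⟨z, hzC, fun y hy => ?_⟩
  refine (TopologicalSpace.isBasis_countableBasis Y).mem_closure_iff.2 fun V hV hyV => ?_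
  rcases Set.mem_iInter.1 hz ⟨V, hV, y, hyV, hy⟩ with h | h
  · obtain ⟨n, hn⟩ := Set.mem_iUnion.1 h
    exact ⟨_, hn, n, rfl⟩
  · exact absurd (subset_closure hzC) h

theorem aeval_pow_apply_comm (T : X →L[ℂ] X) (p : Polynomial ℂ) (n : ℕ) (y : X) :
    Polynomial.aeval T p ((T ^ n) y) = (T ^ n) (Polynomial.aeval T p y) := by
  have h : Commute (Polynomial.aeval T p) (T ^ n) := by
    simpa using (Commute.all p (Polynomial.X ^ n)).map (Polynomial.aeval T)
  exact congrArg (fun S : X →L[ℂ] X => S y) h.eq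

theorem aeval_aeval_apply_comm (T : X →L[ℂ] X) (p q : Polynomial ℂ) (y : X) :
    Polynomial.aeval T p (Polynomial.aeval T q y)
      = Polynomial.aeval T q (Polynomial.aeval T p y) := by
  have h := (Commute.all p q).map (Polynomial.aeval T)
  exact congrArg (fun S : X →L[ℂ] X => S y) h.eq

/-- A version of the Bourdon–Feldman theorem: an orbit which is dense in an open cone containing
its initial point is dense. -/
theorem dense_orbitSet_of_subset_closure {T : X →L[ℂ] X} {z : X} {C : Set X} (hC : IsOpenCone C)
    (hzC : z ∈ C) (hz : C ⊆ closure (Set.range fun n : ℕ => (T ^ (n + 1)) z)) :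
    Dense (orbitSet T z) := by
  set F := closure (Set.range fun n : ℕ => (T ^ (n + 1)) z)
  set U := interior F
  have hCU : C ⊆ U := interior_maximal hz hC.1
  have hUF : U ⊆ F := interior_subset
  have hFc : IsClosed F := isClosed_closure
  have hFO : F ⊆ closure (orbitSet T z) :=
    closure_mono (Set.range_subset_iff.2 fun n => ⟨n + 1, rfl⟩)
  have hTF (y : X) (hy : y ∈ F) : T y ∈ F := by
    refine map_mem_closure T.continuous hy ?_
    rintro _ ⟨n, rfl⟩
    exact ⟨n + 1, congrArg (fun S : X →L[ℂ] X => S z) (pow_succ' T (n + 1))⟩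
  have hTnF (n : ℕ) (y : X) (hy : y ∈ F) : (T ^ n) y ∈ F := by
    induction n with
    | zero => simpa using hy
    | succ n ih => rw [pow_succ', mul_apply_eq_comp]; exact hTF _ ih
  have hmaps {p : Polynomial ℂ} {K : Set X} (hK : IsClosed K)
      (h : ∀ n : ℕ, (T ^ (n + 1)) (Polynomial.aeval T p z) ∈ K) (y : X) (hy : y ∈ F) :
      Polynomial.aeval T p y ∈ K := by
    refine hK.closure_subset_iff.2 subset_rfl (map_mem_closure
      (ContinuousLinearMap.continuous _) hy ?_)
    rintro _ ⟨n, rfl⟩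
    simpa only [aeval_pow_apply_comm] using h n
  have hpoly : Dense (Set.range fun p : Polynomial ℂ => Polynomial.aeval T p z) := by
    let L : Polynomial ℂ →ₗ[ℂ] X :=
      (ContinuousLinearMap.apply ℂ X z : (X →L[ℂ] X) →ₗ[ℂ] X) ∘ₗ
        (Polynomial.aeval T).toLinearMap
    have : Dense ((LinearMap.range L : Submodule ℂ X) : Set X) := by
      refine Submodule.dense_of_isOpen_subset_closure hC.1 hC.2.1 (hz.trans (closure_mono ?_))
      rintro _ ⟨n, rfl⟩
      exact ⟨Polynomial.X ^ (n + 1), by simp [L]⟩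
    exact this
  have hrange {p : Polynomial ℂ} (hp : p ≠ 0) : DenseRange (Polynomial.aeval T p) :=
    denseRange_aeval (denseRange_sub_algebraMap hC (hz.trans hFO)) hp
  have hcompl : Uᶜ = closure Fᶜ := closure_compl.symm
  have hTU (w : X) (hw : w ∉ U) : T w ∉ U := by
    intro hTw
    obtain ⟨y, hyU, hyF⟩ := mem_closure_iff.1 (hcompl ▸ hw : w ∈ closure Fᶜ) (T ⁻¹' U)
      (isOpen_interior.preimage T.continuous) hTw
    obtain ⟨_, ⟨hqU, hqF⟩, q, rfl⟩ := hpoly.inter_open_nonempty (T ⁻¹' U ∩ Fᶜ)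
      ((isOpen_interior.preimage T.continuous).inter hFc.isOpen_compl) ⟨y, hyU, hyF⟩
    refine hqF (hmaps hFc (fun n => ?_) z (hz hzC))
    rw [pow_succ, mul_apply_eq_comp]
    exact hTnF n _ (hUF hqU)
  have hTnU (n : ℕ) (w : X) (hw : w ∉ U) : (T ^ n) w ∉ U := by
    induction n with
    | zero => simpa using hw
    | succ n ih => rw [pow_succ', mul_apply_eq_comp]; exact hTU _ ih
  have hUc : IsClosed Uᶜ := isOpen_interior.isClosed_compl
  have hmem {p : Polynomial ℂ} (hp : p ≠ 0) (hpF : Polynomial.aeval T p z ∈ F) :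
      Polynomial.aeval T p z ∈ U := by
    by_contra hpU
    have hFsub (y : X) (hy : y ∈ F) : Polynomial.aeval T p y ∈ Uᶜ :=
      hmaps hUc (fun n => hTnU _ _ hpU) y hy
    have hall (y : X) : Polynomial.aeval T p y ∉ U := by
      by_cases hy : y ∈ F
      · exact hFsub y hy
      intro hyU
      obtain ⟨_, ⟨hqU, hqF⟩, q, rfl⟩ := hpoly.inter_open_nonempty
        (Polynomial.aeval T p ⁻¹' U ∩ Fᶜ)
        ((isOpen_interior.preimage (ContinuousLinearMap.continuous _)).inter hFc.isOpen_compl)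
        ⟨y, hyU, hy⟩
      rw [Set.mem_preimage, aeval_aeval_apply_comm] at hqU
      exact hmaps hUc (fun n => hTnU _ _ fun h => hqF (hUF h)) _ hpF hqU
    obtain ⟨y, hy⟩ := (hrange hp).exists_mem_open isOpen_interior ⟨z, hCU hzC⟩
    exact hall y hy
  have hnonconst (p : Polynomial ℂ) (hp : 0 < p.natDegree) : Polynomial.aeval T p z ∈ F := by
    let γ : ℝ → Polynomial ℂ := fun t => Polynomial.C (1 - t : ℂ) + Polynomial.C (t : ℂ) * p
    have hγ0 (t : ℝ) : γ t ≠ 0 := by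
      intro h
      have h1 := congrArg (fun q => Polynomial.coeff q p.natDegree) h
      have h2 : t = 0 := by
        simpa only [γ, Polynomial.coeff_add, Polynomial.coeff_C_of_ne_zero hp.ne', zero_add,
          Polynomial.coeff_C_mul, Polynomial.coeff_zero, mul_eq_zero, Complex.ofReal_eq_zero,
          Polynomial.coeff_natDegree, Polynomial.leadingCoeff_eq_zero,
          Polynomial.ne_zero_of_natDegree_gt hp, or_false] using h1
      simp [γ, h2] at h
    have hγ : Continuous fun t => Polynomial.aeval T (γ t) z := by
      have : (fun t => Polynomial.aeval T (γ t) z) = fun t : ℝ =>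
          (1 - t : ℂ) • z + (t : ℂ) • Polynomial.aeval T p z := by
        ext t
        simp [γ, Algebra.algebraMap_eq_smul_one, sub_smul]
      rw [this]
      fun_prop
    have hclopen : IsClopen ((fun t => Polynomial.aeval T (γ t) z) ⁻¹' U) := by
      refine ⟨?_, isOpen_interior.preimage hγ⟩
      have : (fun t => Polynomial.aeval T (γ t) z) ⁻¹' U
          = (fun t => Polynomial.aeval T (γ t) z) ⁻¹' F :=
        Set.Subset.antisymm (Set.preimage_mono hUF) fun t ht => hmem (hγ0 t) ht
      rw [this]
      exact hFc.preimage hγ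
    have huniv := hclopen.eq_univ ⟨0, by simpa [γ] using hCU hzC⟩
    have : (1 : ℝ) ∈ (fun t => Polynomial.aeval T (γ t) z) ⁻¹' U := huniv ▸ Set.mem_univ _
    exact hUF (by simpa [γ] using this)
  have hall (p : Polynomial ℂ) : Polynomial.aeval T p z ∈ F := by
    rcases Nat.eq_zero_or_pos p.natDegree with hp | hp
    · have hcont : Continuous fun t : ℂ => Polynomial.aeval T p z + t • T z := by fun_prop
      have hcl : (0 : ℂ) ∈ closure ({0}ᶜ : Set ℂ) := by simp
      have := map_mem_closure hcont hcl (t := F) fun t (ht : t ≠ 0) => by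
        have hdeg : 0 < (p + Polynomial.C t * Polynomial.X).natDegree := by
          rw [Polynomial.natDegree_add_eq_right_of_natDegree_lt] <;>
            simp [Polynomial.natDegree_C_mul_X t ht, hp]
        simpa [Algebra.algebraMap_eq_smul_one] using hnonconst _ hdeg
      simpa [hFc.closure_eq] using this
    · exact hnonconst p hp
  have := hpoly.mono (Set.range_subset_iff.2 hall)
  rw [dense_iff_closure_eq, hFc.closure_eq] at this
  exact dense_iff_closure_eq.2 (Set.univ_subset_iff.1 (this ▸ hFO))

theorem hypercyclic_of_coarsely_dense_on_cone [CompleteSpace X]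
    (hinf : ¬ FiniteDimensional ℂ X)
    (T : X →L[ℂ] X) (x : X) (d : ℝ) (hd : 0 < d)
    (C : Set X) (hC : IsOpenCone C) (hdense : C ⊆ coarseOrbit T x d) :
    ∃ z : X, Dense (orbitSet T z) := by
  have := separableSpace_of_coarsely_dense hd hC hdense
  have := UniformSpace.secondCountable_of_separable X
  obtain ⟨z, hzC, hz⟩ := exists_mem_subset_closure_range_iterate
    (g := fun n y => (T ^ (n + 1)) y) (fun n => (T ^ (n + 1)).continuous) hC.1 hC.2.1
    fun U V hU hV hUC hVC =>
      exists_pow_succ_mem_of_coarsely_dense hinf hd hC hdense hU hUC hV hVC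
  exact ⟨z, dense_orbitSet_of_subset_closure hC hzC hz⟩
end

section
/- Let T : X → X be a bounded linear operator on an infinite dimensional complex Banach space X such that ⋂_{x∈X} D(x,T) has non-empty interior. Then T is topologically transitive: for all nonempty open U, V ⊆ X there exists n ≥ 0 with T^n(U) ∩ V ≠ ∅. -/
open Filter Topology

variable {X : Type*} [NormedAddCommGroup X] [NormedSpace ℂ X]

/-- If every `T - μ` has dense range, then so does `q(T)` for every nonzero polynomial `q`. -/
theorem denseRange_aeval_s12 (T : X →L[ℂ] X) (hT : ∀ μ : ℂ, DenseRange fun x => T x - μ • x)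
    {q : Polynomial ℂ} (hq : q ≠ 0) : DenseRange (Polynomial.aeval T q) := by
  have hroots : ∀ s : Multiset ℂ,
      DenseRange (Polynomial.aeval T (s.map fun a => Polynomial.X - Polynomial.C a).prod) := by
    intro s
    induction s using Multiset.induction with
    | empty => simpa using Function.surjective_id.denseRange
    | cons a s ih =>
      have ha : DenseRange (Polynomial.aeval T (Polynomial.X - Polynomial.C a)) := by
        convert hT a using 1
        ext x
        simp [Algebra.algebraMap_eq_smul_one]
      rw [Multiset.map_cons, Multiset.prod_cons, map_mul, ContinuousLinearMap.mul_def,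
        ContinuousLinearMap.coe_comp]
      exact ha.comp ih (ContinuousLinearMap.continuous _)
  have hlead : DenseRange fun x : X => q.leadingCoeff • x := by
    refine Function.Surjective.denseRange fun y => ⟨q.leadingCoeff⁻¹ • y, ?_⟩
    exact smul_inv_smul₀ (Polynomial.leadingCoeff_ne_zero.mpr hq) y
  rw [(IsAlgClosed.splits q).eq_prod_roots]
  convert hlead.comp (hroots q.roots) (continuous_const_smul _) using 1
  ext x
  simp [Algebra.algebraMap_eq_smul_one]

/-- The points `y` such that every nonempty open set meets every neighbourhood of `y` under some
iterate of `T`. -/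
def reachableSet (T : X →L[ℂ] X) : Set X :=
  {y | ∀ U V : Set X, IsOpen U → U.Nonempty → IsOpen V → y ∈ V → ∃ n : ℕ, ∃ x ∈ U, (T ^ n) x ∈ V}

theorem iInter_dSet_subset_reachableSet (T : X →L[ℂ] X) :
    ⋂ x : X, dSet T x ⊆ reachableSet T := by
  rintro y hy U V hU ⟨x, hx⟩ hV hyV
  rcases Set.mem_iInter.mp hy x with ⟨n, rfl⟩ | ⟨k, -, -, u, hu, huy⟩
  · exact ⟨n, x, hx, hyV⟩
  · obtain ⟨n, hn, hn'⟩ :=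
      ((hu.eventually_mem (hU.mem_nhds hx)).and (huy.eventually_mem (hV.mem_nhds hyV))).exists
    exact ⟨k n, u n, hn, hn'⟩

theorem isClosed_reachableSet (T : X →L[ℂ] X) : IsClosed (reachableSet T) := by
  refine isClosed_of_closure_subset fun y hy U V hU hUne hV hyV => ?_
  obtain ⟨z, hzV, hz⟩ := mem_closure_iff.mp hy V hV hyV
  exact hz U V hU hUne hV hzV

theorem Commute.map_mem_reachableSet {T S : X →L[ℂ] X} (hTS : Commute S T) (hS : DenseRange S)
    {y : X} (hy : y ∈ reachableSet T) : S y ∈ reachableSet T := by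
  intro U V hU hUne hV hyV
  obtain ⟨n, x, hxU, hxV⟩ := hy (S ⁻¹' U) (S ⁻¹' V) (hU.preimage S.continuous)
    (hS.exists_mem_open hU hUne) (hV.preimage S.continuous) hyV
  refine ⟨n, S x, hxU, ?_⟩
  have h := DFunLike.congr_fun (hTS.pow_right n).eq x
  simp only [mul_apply_eq_comp] at h
  rwa [← h]

theorem smul_mem_reachableSet {T : X →L[ℂ] X} {c : ℂ} (hc : c ≠ 0) {y : X}
    (hy : y ∈ reachableSet T) : c • y ∈ reachableSet T := by
  have hcomm : Commute (c • (1 : X →L[ℂ] X)) T := (Commute.one_left T).smul_left c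
  refine hcomm.map_mem_reachableSet (Function.Surjective.denseRange fun z => ⟨c⁻¹ • z, ?_⟩) hy
  exact smul_inv_smul₀ hc z

/-- If the reachable set has interior, then the adjoint of `T` has no eigenvalues. -/
theorem denseRange_sub_smul_of_interior_reachableSet {T : X →L[ℂ] X}
    (hT : (interior (reachableSet T)).Nonempty) (μ : ℂ) : DenseRange fun x => T x - μ • x := by
  let S : X →L[ℂ] X := T - μ • 1
  change Dense (Set.range S)
  by_contra hS
  obtain ⟨x, hx⟩ : ∃ x, x ∉ closure (Set.range S) := by simpa [Dense] using hS
  let p : Submodule ℂ X := S.range.topologicalClosure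
  have hconv : Convex ℝ (closure (Set.range S)) :=
    (p.restrictScalars ℝ).convex
  obtain ⟨f, u, hfu, hux⟩ := RCLike.geometric_hahn_banach_closed_point (𝕜 := ℂ) hconv
    isClosed_closure hx
  have hfS : ∀ z, f (S z) = 0 := by
    intro z
    by_contra hz
    have h := hfu (S (((u : ℂ) / f (S z)) • z)) (subset_closure ⟨_, rfl⟩)
    rw [map_smul, map_smul, smul_eq_mul, div_mul_cancel₀ _ hz] at h
    simp at h
  have hfT : ∀ z, f (T z) = μ * f z := by
    intro z
    have h := hfS z
    simpa [S, sub_eq_zero] using h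
  have hfTn : ∀ (n : ℕ) z, f ((T ^ n) z) = μ ^ n * f z := by
    intro n z
    induction n with
    | zero => simp
    | succ n ih => rw [pow_succ', mul_apply_eq_comp, hfT, ih, pow_succ', mul_assoc]
  have hfx : f x ≠ 0 := by
    intro h
    have h0 := hfu (S 0) (subset_closure ⟨_, rfl⟩)
    simp only [map_zero, h] at h0 hux
    linarith
  have hfc : Continuous fun z => ‖f z‖ := f.continuous.norm
  obtain ⟨w, hw, hfw⟩ : ∃ w ∈ reachableSet T, f w ≠ 0 := by
    obtain ⟨w, hw⟩ := hT
    by_cases hfw : f w = 0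
    · have hcont : Tendsto (fun t : ℂ => w + t • x) (𝓝[≠] 0) (𝓝 w) := by
        have : Continuous fun t : ℂ => w + t • x := by fun_prop
        simpa using (this.tendsto 0).mono_left nhdsWithin_le_nhds
      obtain ⟨t, ht, ht0⟩ :=
        ((hcont.eventually_mem (mem_interior_iff_mem_nhds.mp hw)).and
          self_mem_nhdsWithin).exists
      exact ⟨w + t • x, ht, by simpa [hfw, hfx] using ht0⟩
    · exact ⟨w, interior_subset hw, hfw⟩
  have hpos : 0 < ‖f w‖ := norm_pos_iff.mpr hfw
  rcases le_total ‖μ‖ 1 with hμ | hμ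
  · obtain ⟨n, z, hz, hnz⟩ := hw {z | ‖f z‖ < ‖f w‖ / 2} {z | ‖f w‖ / 2 < ‖f z‖}
      (isOpen_lt hfc continuous_const) ⟨0, by simpa using hfw⟩ (isOpen_lt continuous_const hfc)
      (by simpa using hpos)
    simp only [Set.mem_ofPred_eq, hfTn, norm_mul, norm_pow] at hz hnz
    have := mul_le_of_le_one_left (norm_nonneg (f z)) (pow_le_one₀ (n := n) (norm_nonneg μ) hμ)
    linarith
  · obtain ⟨n, z, hz, hnz⟩ := hw {z | 2 * ‖f w‖ < ‖f z‖} {z | ‖f z‖ < 2 * ‖f w‖}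
      (isOpen_lt continuous_const hfc) ⟨(3 : ℂ) • w, by
        simp only [Set.mem_ofPred_eq, map_smul, norm_smul, RCLike.norm_ofNat]; linarith⟩
      (isOpen_lt hfc continuous_const)
      (by simp only [Set.mem_ofPred_eq]; linarith)
    simp only [Set.mem_ofPred_eq, hfTn, norm_mul, norm_pow] at hz hnz
    have := le_mul_of_one_le_left (norm_nonneg (f z)) (one_le_pow₀ (n := n) hμ)
    linarith

theorem pow_apply_sub_two_smul_mem_reachableSet {T : X →L[ℂ] X}
    (hT : (interior (reachableSet T)).Nonempty) (n : ℕ) {z : X} (hz : z ∈ reachableSet T) :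
    (T ^ n) z - (2 : ℂ) • z ∈ reachableSet T := by
  have hq : (Polynomial.X ^ n - Polynomial.C 2 : Polynomial ℂ) ≠ 0 := by
    intro h
    have h1 := congrArg (Polynomial.eval 1) h
    norm_num at h1
  have hdense := denseRange_aeval_s12 T (denseRange_sub_smul_of_interior_reachableSet hT) hq
  have hcomm :
      Commute (Polynomial.aeval T (Polynomial.X ^ n - Polynomial.C 2 : Polynomial ℂ)) T := by
    simpa only [Polynomial.aeval_X] using
      (Commute.all (Polynomial.X ^ n - Polynomial.C 2 : Polynomial ℂ) Polynomial.X).map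
        (Polynomial.aeval T)
  have hmem := hcomm.map_mem_reachableSet hdense hz
  rw [map_sub, map_pow, Polynomial.aeval_X, Polynomial.aeval_C,
    Algebra.algebraMap_eq_smul_one] at hmem
  exact hmem

theorem reachableSet_eq_univ {T : X →L[ℂ] X} (hT : (interior (reachableSet T)).Nonempty) :
    reachableSet T = Set.univ := by
  obtain ⟨w, hw⟩ := id hT
  have hsmall : ∀ v, w + v ∈ reachableSet T → v ∈ reachableSet T := by
    intro v hv
    rw [← (isClosed_reachableSet T).closure_eq, mem_closure_iff]
    intro V hV hvV
    have hcont : Continuous fun y : X × X => y.2 - (2 : ℂ) • y.1 := by fun_prop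
    have hmem : ((2 : ℂ)⁻¹ • w, w + v) ∈ (fun y : X × X => y.2 - (2 : ℂ) • y.1) ⁻¹' V := by
      simpa using hvV
    obtain ⟨U, V', hU, hV', hwU, hvV', hsub⟩ := isOpen_prod_iff.mp (hV.preimage hcont) _ _ hmem
    obtain ⟨n, z, ⟨hzU, hzw⟩, hzV⟩ := hv
      (U ∩ (fun z : X => (2 : ℂ) • z) ⁻¹' interior (reachableSet T)) V'
      (hU.inter (isOpen_interior.preimage (continuous_const_smul _)))
      ⟨(2 : ℂ)⁻¹ • w, hwU, by simpa using hw⟩ hV' hvV'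
    have hz : z ∈ reachableSet T := by
      simpa using smul_mem_reachableSet (inv_ne_zero (two_ne_zero (α := ℂ))) (interior_subset hzw)
    exact ⟨(T ^ n) z - (2 : ℂ) • z, hsub (Set.mk_mem_prod hzU hzV),
      pow_apply_sub_two_smul_mem_reachableSet hT n hz⟩
  refine Set.eq_univ_of_forall fun v => ?_
  have hcont : Tendsto (fun t : ℂ => w + t • v) (𝓝[≠] 0) (𝓝 w) := by
    have : Continuous fun t : ℂ => w + t • v := by fun_prop
    simpa using (this.tendsto 0).mono_left nhdsWithin_le_nhds
  obtain ⟨t, ht, ht0⟩ :=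
    ((hcont.eventually_mem (mem_interior_iff_mem_nhds.mp hw)).and self_mem_nhdsWithin).exists
  have ht0 : t ≠ 0 := ht0
  simpa [smul_smul, ht0] using smul_mem_reachableSet (inv_ne_zero ht0) (hsmall (t • v) ht)

theorem topologically_transitive_of_dSet_interior [CompleteSpace X]
    (hinf : ¬ FiniteDimensional ℂ X)
    (T : X →L[ℂ] X) (hint : (interior (⋂ x : X, dSet T x)).Nonempty) :
    ∀ U V : Set X, IsOpen U → U.Nonempty → IsOpen V → V.Nonempty →
      ∃ n : ℕ, ((T ^ n) '' U ∩ V).Nonempty := by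
  rintro U V hU hUne hV ⟨y, hyV⟩
  have huniv := reachableSet_eq_univ
    (hint.mono (interior_mono (iInter_dSet_subset_reachableSet T)))
  have hy : y ∈ reachableSet T := huniv ▸ Set.mem_univ y
  obtain ⟨n, x, hx, hxV⟩ := hy U V hU hUne hV hyV
  exact ⟨n, (T ^ n) x, ⟨x, hx, rfl⟩, hxV⟩
end
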